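/- There exist a constant c > 0 and an integer n₀ such that for every n ≥ n₀ and every integer k with 4 ≤ k ≤ n/(4·log₂ n), every resolution refutation of the 3-CNF formula ERPHP has size at least c · n^{k−1} / (k · (16/15)^{k−1} · (2k·log₂ n)^k). -/

import Mathlib

namespace NarrowProofs

/-- A clause is a finite set of literals; a literal is a variable together with a
sign (`true` = positive literal, `false` = negative literal). -/
abbrev Clause (V : Type) := Finset (V × Bool)

/-- Justification of a step in a resolution derivation. -/
inductive ResJust (V : Type) where
  | ax : ResJust V
  | res (i j : ℕ) (x : V) : ResJust V
  | weak (i : ℕ) : ResJust V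

/-- A resolution refutation of a CNF formula `F`. -/
structure ResRefutation (V : Type) [DecidableEq V] (F : Set (Clause V)) where
  lines : List (Clause V)
  justs : List (ResJust V)
  len_eq : justs.length = lines.length
  ne : lines ≠ []
  valid : ∀ t C, lines[t]? = some C →
    match justs[t]? with
    | some ResJust.ax => C ∈ F
    | some (ResJust.res i j x) => i < t ∧ j < t ∧ ∃ A B : Clause V,
        lines[i]? = some A ∧ lines[j]? = some B ∧
        (x, true) ∈ A ∧ (x, false) ∈ B ∧
        C = (A.erase (x, true)) ∪ (B.erase (x, false))
    | some (ResJust.weak i) => i < t ∧ ∃ A : Clause V, lines[i]? = some A ∧ A ⊆ C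
    | none => False
  last_empty : lines.getLast ne = ∅

variable {V : Type} [DecidableEq V] {F : Set (Clause V)}

/-- The size (length) of a resolution refutation: the number of clauses. -/
def ResRefutation.size (π : ResRefutation V F) : ℕ := π.lines.length

/-- The variables of the 3-CNF relativized pigeonhole principle `ERPHP`. -/
inductive ERVar where
  | p (u v : ℕ)
  | q (v w : ℕ)
  | r (v : ℕ)
  | rr (v v' : ℕ)
  | y (u v : ℕ)
  | z (v w : ℕ)
deriving DecidableEq

/-- The 3-CNF relativized pigeonhole principle formula with `k` pigeons chosen
among `n` and `k-1` holes (all indices are 1-based). -/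
def ERPHP (n k : ℕ) : Set (Clause ERVar) :=
  { C |
    (∃ u, 1 ≤ u ∧ u ≤ k ∧
      C = {(ERVar.p u 1, true), (ERVar.p u 2, true), (ERVar.y u 2, true)}) ∨
    (∃ u v, 1 ≤ u ∧ u ≤ k ∧ 2 ≤ v ∧ v ≤ n - 3 ∧
      C = {(ERVar.y u v, false), (ERVar.p u (v+1), true), (ERVar.y u (v+1), true)}) ∨
    (∃ u, 1 ≤ u ∧ u ≤ k ∧
      C = {(ERVar.y u (n-2), false), (ERVar.p u (n-1), true), (ERVar.p u n, true)}) ∨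
    (∃ v, 1 ≤ v ∧ v ≤ n ∧
      C = {(ERVar.r v, false), (ERVar.q v 1, true), (ERVar.z v 1, true)}) ∨
    (∃ v w, 1 ≤ v ∧ v ≤ n ∧ 1 ≤ w ∧ w ≤ k - 4 ∧
      C = {(ERVar.z v w, false), (ERVar.q v (w+1), true), (ERVar.z v (w+1), true)}) ∨
    (∃ v, 1 ≤ v ∧ v ≤ n ∧
      C = {(ERVar.z v (k-3), false), (ERVar.q v (k-2), true), (ERVar.q v (k-1), true)}) ∨
    (∃ u u' v, 1 ≤ u ∧ u ≤ k ∧ 1 ≤ u' ∧ u' ≤ k ∧ u ≠ u' ∧ 1 ≤ v ∧ v ≤ n ∧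
      C = {(ERVar.p u v, false), (ERVar.p u' v, false)}) ∨
    (∃ u v, 1 ≤ u ∧ u ≤ k ∧ 1 ≤ v ∧ v ≤ n ∧
      C = {(ERVar.p u v, false), (ERVar.r v, true)}) ∨
    (∃ v v', 1 ≤ v ∧ v ≤ n ∧ 1 ≤ v' ∧ v' ≤ n ∧ v ≠ v' ∧
      C = {(ERVar.r v, false), (ERVar.r v', false), (ERVar.rr v v', true)}) ∨
    (∃ v v' w, 1 ≤ v ∧ v ≤ n ∧ 1 ≤ v' ∧ v' ≤ n ∧ v ≠ v' ∧ 1 ≤ w ∧ w ≤ k - 1 ∧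
      C = {(ERVar.rr v v', false), (ERVar.q v w, false), (ERVar.q v' w, false)}) }

/-- Truth assignments built from a placement `f` of pigeons, outside bits `σ`, and holes `h`. -/
def asg {k : ℕ} (f : Fin k → ℕ) (σ : ℕ → Prop) (h : Fin k → ℕ) : ERVar → Prop
  | ERVar.p u v => ∃ i : Fin k, i.val + 1 = u ∧ f i = v
  | ERVar.y u v => ∃ i : Fin k, i.val + 1 = u ∧ v < f i
  | ERVar.r v => ∃ i, f i = v
  | ERVar.rr v v' => (∃ i, f i = v) ∧ ∃ i, f i = v'
  | ERVar.q v w => (∃ i, f i = v ∧ h i = w) ∨ ((∀ i, f i ≠ v) ∧ σ v)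
  | ERVar.z v w => (∃ i, f i = v ∧ w < h i) ∨ ((∀ i, f i ≠ v) ∧ σ v)

/-- The vertex mentioned by a variable. -/
def vert : ERVar → Option ℕ
  | ERVar.q v _ => some v
  | ERVar.z v _ => some v
  | _ => none

/-- Satisfaction of a clause. -/
def Sat (a : ERVar → Prop) (C : Clause ERVar) : Prop := ∃ l ∈ C, (a l.1 ↔ l.2 = true)

/-- A clause mentions a vertex. -/
def Ment (C : Clause ERVar) (v : ℕ) : Prop := ∃ l ∈ C, vert l.1 = some v

lemma sat_axiom {n k : ℕ} (hn : 4 ≤ n) (hk : 4 ≤ k) (f : Fin k → ℕ) (hf : Function.Injective f)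
    (hf1 : ∀ i, 1 ≤ f i) (hfn : ∀ i, f i ≤ n) (σ : ℕ → Prop) (h : Fin k → ℕ)
    (hh : Function.Injective h) (hh1 : ∀ i, 1 ≤ h i) (hhk : ∀ i, h i ≤ k)
    (C : Clause ERVar) (hC : C ∈ ERPHP n k)
    (hm : ∀ i, h i = k → ¬ Ment C (f i)) : Sat (asg f σ h) C := by
  by_contra hs
  have hs' : ∀ l ∈ C, ¬ (asg f σ h l.1 ↔ l.2 = true) := fun l hl h' => hs ⟨l, hl, h'⟩
  have hm' : ∀ i, h i = k → ∀ l ∈ C, vert l.1 ≠ some (f i) := fun i hi l hl h' => hm i hi ⟨l, hl, h'⟩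
  clear hs hm
  rcases hC with ⟨u, h1, h2, rfl⟩ | ⟨u, v, h1, h2, h3, h4, rfl⟩ | ⟨u, h1, h2, rfl⟩ |
    ⟨v, h1, h2, rfl⟩ | ⟨v, w, h1, h2, h3, h4, rfl⟩ | ⟨v, h1, h2, rfl⟩ |
    ⟨u, u', v, h1, h2, h3, h4, h5, h6, h7, rfl⟩ | ⟨u, v, h1, h2, h3, h4, rfl⟩ |
    ⟨v, v', h1, h2, h3, h4, h5, rfl⟩ | ⟨v, v', w, h1, h2, h3, h4, h5, h6, h7, rfl⟩ <;>
    simp only [Finset.mem_insert, Finset.mem_singleton, forall_eq_or_imp, forall_eq, asg, vert,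
      iff_true, iff_false, Bool.false_eq_true, not_not] at hs' hm' <;>
    try simp only [not_exists, not_and, not_or] at hs'
  · obtain ⟨a, b, c⟩ := hs'
    have e : (⟨u - 1, by omega⟩ : Fin k).val + 1 = u := by simp; omega
    have a' := a _ e
    have b' := b _ e
    have c' := c _ e
    have := hf1 ⟨u - 1, by omega⟩
    omega
  · obtain ⟨⟨i, hi, hi'⟩, b, c⟩ := hs'
    have b' := b _ hi
    have c' := c _ hi
    omega
  · obtain ⟨⟨i, hi, hi'⟩, b, c⟩ := hs'
    have b' := b _ hi
    have c' := c _ hi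
    have := hfn i
    omega
  · obtain ⟨⟨i, hi⟩, b, c⟩ := hs'
    have b' := b.1 _ hi
    have c' := c.1 _ hi
    have := hh1 i
    omega
  · obtain ⟨⟨i, hi, hi'⟩ | a, b, c⟩ := hs'
    · have b' := b.1 _ hi
      have c' := c.1 _ hi
      omega
    · exact b.2 a.1 a.2
  · obtain ⟨⟨i, hi, hi'⟩ | a, b, c⟩ := hs'
    · have b' := b.1 _ hi
      have c' := c.1 _ hi
      have := hhk i
      have hne : h i ≠ k := fun e => (hm' i e).1 (by rw [hi])
      omega
    · exact b.2 a.1 a.2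
  · obtain ⟨⟨i, hi, hi'⟩, ⟨j, hj, hj'⟩⟩ := hs'
    have : i = j := hf (by omega)
    subst this
    omega
  · obtain ⟨⟨i, hi, hi'⟩, a⟩ := hs'
    exact a i hi'
  · obtain ⟨⟨i, hi⟩, ⟨j, hj⟩, a⟩ := hs'
    exact a ⟨i, hi⟩ j hj
  · obtain ⟨⟨⟨i, hi⟩, ⟨j, hj⟩⟩, a, b⟩ := hs'
    rcases a with ⟨i', hi', hw⟩ | a
    · rcases b with ⟨j', hj', hw'⟩ | b
      · have : i' = j' := hh (by omega)
        subst this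
        omega
      · exact b.1 j hj
    · exact a.1 i hi

/-- hole assignment coming from a permutation -/
def holes {k : ℕ} (e : Equiv.Perm (Fin k)) (i : Fin k) : ℕ := (e i).val + 1

lemma asg_congr {k : ℕ} (f : Fin k → ℕ) (σ : ℕ → Prop) (h h' : Fin k → ℕ) (x : ERVar)
    (hx : ∀ i, vert x = some (f i) → h i = h' i) : asg f σ h x ↔ asg f σ h' x := by
  cases x with
  | q v w =>
    simp only [asg, vert, Option.some.injEq] at *
    refine or_congr (exists_congr fun i => and_congr_right fun hi => ?_) Iff.rfl
    rw [hx i hi.symm]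
  | z v w =>
    simp only [asg, vert, Option.some.injEq] at *
    refine or_congr (exists_congr fun i => and_congr_right fun hi => ?_) Iff.rfl
    rw [hx i hi.symm]
  | _ => simp [asg]

lemma sat_resolve (a : ERVar → Prop) (A B : Clause ERVar) (x : ERVar) (hA : Sat a A)
    (hB : Sat a B) : Sat a ((A.erase (x, true)) ∪ (B.erase (x, false))) := by
  by_cases hx : a x
  · obtain ⟨l, hl, hl'⟩ := hB
    refine ⟨l, ?_, hl'⟩
    refine Finset.mem_union_right _ (Finset.mem_erase.2 ⟨?_, hl⟩)
    rintro rfl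
    simp [hx] at hl'
  · obtain ⟨l, hl, hl'⟩ := hA
    refine ⟨l, ?_, hl'⟩
    refine Finset.mem_union_left _ (Finset.mem_erase.2 ⟨?_, hl⟩)
    rintro rfl
    simp [hx] at hl'

lemma exists_wide {n k : ℕ} (hn : 4 ≤ n) (hk : 4 ≤ k) (f : Fin k → ℕ)
    (hf : Function.Injective f)
    (hf1 : ∀ i, 1 ≤ f i) (hfn : ∀ i, f i ≤ n) (σ : ℕ → Prop)
    (π : ResRefutation ERVar (ERPHP n k)) :
    ∃ C ∈ π.lines, ∃ h : Fin k → ℕ, ¬ Sat (asg f σ h) C ∧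
      ∃ u0, ∀ u, u ≠ u0 → Ment C (f u) := by
  by_contra hcon
  push Not at hcon
  have key : ∀ (t : ℕ) (C : Clause ERVar), π.lines[t]? = some C → ∀ e : Equiv.Perm (Fin k),
      (∀ i, holes e i = k → ¬ Ment C (f i)) → Sat (asg f σ (holes e)) C := by
    intro t
    induction t using Nat.strong_induction_on with
    | _ t ih =>
    intro C hC e he
    have hv := π.valid t C hC
    have hinj : Function.Injective (holes e) := by
      intro i j hij
      simp only [holes] at hij
      exact e.injective (Fin.ext (by omega))
    split at hv
    · exact sat_axiom hn hk f hf hf1 hfn σ _ hinj (fun i => by simp [holes])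
        (fun i => (e i).isLt) C hv he
    · rename_i i j x _
      obtain ⟨hi, hj, A, B, hA, hB, hxA, hxB, rfl⟩ := hv
      have mem : ∀ u, ¬ Ment ((A.erase (x, true)) ∪ (B.erase (x, false))) (f u) →
          vert x ≠ some (f u) → ¬ Ment A (f u) ∧ ¬ Ment B (f u) := by
        intro u hu hx
        constructor
        · rintro ⟨l, hl, hl'⟩
          refine hu ⟨l, Finset.mem_union_left _ (Finset.mem_erase.2 ⟨?_, hl⟩), hl'⟩
          rintro rfl
          exact hx hl'
        · rintro ⟨l, hl, hl'⟩
          refine hu ⟨l, Finset.mem_union_right _ (Finset.mem_erase.2 ⟨?_, hl⟩), hl'⟩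
          rintro rfl
          exact hx hl'
      by_cases hx : ∀ u, holes e u = k → vert x ≠ some (f u)
      · exact sat_resolve _ _ _ _ (ih i hi A hA e fun u hu => (mem u (he u hu) (hx u hu)).1)
          (ih j hj B hB e fun u hu => (mem u (he u hu) (hx u hu)).2)
      · push Not at hx
        obtain ⟨u0, hu0, hxu⟩ := hx
        by_contra hns
        obtain ⟨u1, hne, hu1⟩ := hcon _ (List.mem_of_getElem? hC) _ hns u0
        apply hns
        set e' : Equiv.Perm (Fin k) := (Equiv.swap u0 u1).trans e with he'
        have hlast : ∀ u, holes e' u = k → u = u1 := by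
          intro u hu
          have h1 : holes e (Equiv.swap u0 u1 u) = holes e u0 := by
            rw [hu0]; exact hu
          have h2 := hinj h1
          rw [Equiv.swap_apply_eq_iff] at h2
          simpa using h2
        have hx1 : vert x ≠ some (f u1) := by
          rw [hxu]
          intro h
          exact hne (hf (Option.some.inj h)).symm
        have hs : Sat (asg f σ (holes e')) ((A.erase (x, true)) ∪ (B.erase (x, false))) := by
          refine sat_resolve _ _ _ _ (ih i hi A hA e' fun u hu => ?_) (ih j hj B hB e' fun u hu => ?_)
          · rw [hlast u hu]; exact (mem u1 hu1 hx1).1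
          · rw [hlast u hu]; exact (mem u1 hu1 hx1).2
        obtain ⟨l, hl, hl'⟩ := hs
        refine ⟨l, hl, ?_⟩
        rw [← hl']
        apply asg_congr
        intro u hu
        have n0 : u ≠ u0 := by
          rintro rfl
          exact he _ hu0 ⟨l, hl, hu⟩
        have n1 : u ≠ u1 := by
          rintro rfl
          exact hu1 ⟨l, hl, hu⟩
        simp [holes, he', Equiv.swap_apply_of_ne_of_ne n0 n1]
    · obtain ⟨hi, A, hA, hAC⟩ := hv
      obtain ⟨l, hl, hl'⟩ := ih _ hi A hA e fun u hu ⟨l, hl, hl'⟩ => he u hu ⟨l, hAC hl, hl'⟩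
      exact ⟨l, hAC hl, hl'⟩
    · exact hv.elim
  have hlast : π.lines[π.lines.length - 1]? = some ∅ := by
    rw [← π.last_empty, List.getLast_eq_getElem, List.getElem?_eq_getElem]
  obtain ⟨l, hl, -⟩ := key _ _ hlast 1 (fun i _ ⟨l, hl, _⟩ => by simp at hl)
  simp at hl

/-- outside bits from a finite set -/
def bits {n : ℕ} (s : Finset (Fin n)) (v : ℕ) : Prop := ∃ j ∈ s, j.val + 1 = v

/-- placement from an embedding -/
def place {n k : ℕ} (g : Fin k ↪ Fin n) (i : Fin k) : ℕ := (g i).val + 1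

/-- A pair (placement, bits) is bad for a clause. -/
def Bad {n k : ℕ} (C : Clause ERVar) (g : Fin k ↪ Fin n) (s : Finset (Fin n)) : Prop :=
  ∃ h : Fin k → ℕ, ¬ Sat (asg (place g) (bits s) h) C ∧
      ∃ u0, ∀ u, u ≠ u0 → Ment C (place g u)

open Classical in
lemma card_bits {n : ℕ} (T : Finset (Fin n)) (b : Fin n → Prop) :
    (Finset.univ.filter fun s : Finset (Fin n) => ∀ v ∈ T, (v ∈ s ↔ b v)).card ≤
      2 ^ (n - T.card) := by
  have : (2 : ℕ) ^ (n - T.card) = (Tᶜ.powerset).card := by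
    rw [Finset.card_powerset, Finset.card_compl, Fintype.card_fin]
  rw [this]
  apply Finset.card_le_card_of_injOn (fun s => s \ T)
  · intro s _
    simp only [Finset.coe_powerset, Set.mem_preimage, Set.mem_powerset_iff]
    intro v hv
    simp at hv ⊢
    exact hv.2
  · intro s hs s' hs' he
    simp only [Finset.coe_filter, Finset.mem_univ, true_and, Set.mem_ofPred_eq] at hs hs'
    ext v
    by_cases hv : v ∈ T
    · rw [hs v hv, hs' v hv]
    · have : v ∈ s \ T ↔ v ∈ s' \ T := by
        have he' : s \ T = s' \ T := he
        rw [he']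
      simpa [hv] using this

open Classical in
lemma card_bad {n k : ℕ} (L : ℕ) (C : Clause ERVar) :
    ((Finset.univ ×ˢ Finset.univ).filter
        fun x : (Fin k ↪ Fin n) × Finset (Fin n) => Bad C x.1 x.2).card
      ≤ k * (n * L ^ (k - 1)) * 2 ^ n ∨
    ((Finset.univ ×ˢ Finset.univ).filter
        fun x : (Fin k ↪ Fin n) × Finset (Fin n) => Bad C x.1 x.2).card * 2 ^ (L + 1 - k)
      ≤ n.descFactorial k * 2 ^ n := by
  set M : Finset (Fin n) := Finset.univ.filter fun v => Ment C (v.val + 1) with hM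
  rcases le_or_gt M.card L with hL | hL
  · left
    have h1 : ((Finset.univ ×ˢ Finset.univ).filter
        fun x : (Fin k ↪ Fin n) × Finset (Fin n) => Bad C x.1 x.2) ⊆
        (Finset.univ.biUnion fun u0 : Fin k =>
          Finset.univ.filter fun g : Fin k ↪ Fin n => ∀ u, u ≠ u0 → g u ∈ M) ×ˢ Finset.univ := by
      rintro ⟨g, s⟩ hx
      simp only [Finset.mem_filter, Finset.mem_product, Finset.mem_univ, true_and, and_true,
        Finset.mem_biUnion] at hx ⊢
      obtain ⟨h, -, u0, hu⟩ := hx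
      exact ⟨u0, fun u hne => by simpa [hM, place] using hu u hne⟩
    refine (Finset.card_le_card h1).trans ?_
    rw [Finset.card_product]
    have h2 : (Finset.univ : Finset (Finset (Fin n))).card = 2 ^ n := by simp
    rw [h2]
    refine Nat.mul_le_mul_right _ ?_
    refine (Finset.card_biUnion_le_card_mul _ _ (n * L ^ (k - 1)) ?_).trans (by simp)
    intro u0 _
    have h3 : (Fintype.piFinset fun u : Fin k => if u = u0 then Finset.univ else M).card
        ≤ n * L ^ (k - 1) := by
      rw [Fintype.card_piFinset, ← Finset.mul_prod_erase _ _ (Finset.mem_univ u0)]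
      simp only [if_true, Finset.card_univ, Fintype.card_fin]
      refine Nat.mul_le_mul_left _ ?_
      refine (Finset.prod_le_pow_card _ _ L ?_).trans (by simp)
      intro u hu
      rw [if_neg (Finset.ne_of_mem_erase hu)]
      exact hL
    refine le_trans ?_ h3
    apply Finset.card_le_card_of_injOn (fun g : Fin k ↪ Fin n => (g : Fin k → Fin n))
    · intro g hg
      simp only [Finset.coe_filter, Finset.mem_univ, true_and, Set.mem_ofPred_eq] at hg
      simp only [Finset.mem_coe, Fintype.mem_piFinset]
      intro u
      split_ifs with hu
      · simp
      · exact hg u hu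
    · intro g _ g' _ he
      exact DFunLike.coe_injective he
  · right
    have hMn : M.card ≤ n := by simpa using Finset.card_le_univ M
    have hchoose : ∀ v : Fin n, ∃ l : ERVar × Bool, v ∈ M → l ∈ C ∧ vert l.1 = some (v.val + 1) := by
      intro v
      by_cases hv : v ∈ M
      · have : Ment C (v.val + 1) := by simpa [hM] using hv
        obtain ⟨l, hl⟩ := this
        exact ⟨l, fun _ => hl⟩
      · exact ⟨(ERVar.r 0, true), fun h => absurd h hv⟩
    choose lit hlit using hchoose
    have h1 : ((Finset.univ ×ˢ Finset.univ).filter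
        fun x : (Fin k ↪ Fin n) × Finset (Fin n) => Bad C x.1 x.2) ⊆
        Finset.univ.biUnion fun g : Fin k ↪ Fin n =>
          ({g} : Finset (Fin k ↪ Fin n)) ×ˢ (Finset.univ.filter fun s : Finset (Fin n) =>
            ∀ v ∈ M \ Finset.univ.map g, (v ∈ s ↔ ¬ (lit v).2 = true)) := by
      rintro ⟨g, s⟩ hx
      simp only [Finset.mem_filter, Finset.mem_product, Finset.mem_univ, true_and,
        Finset.mem_biUnion, Finset.mem_singleton] at hx ⊢
      obtain ⟨h, hns, -⟩ := hx
      refine ⟨g, rfl, ?_⟩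
      intro v hv
      rw [Finset.mem_sdiff] at hv
      obtain ⟨hvM, hvg⟩ := hv
      obtain ⟨hl, hvl⟩ := hlit v hvM
      have hnl : ¬ (asg (place g) (bits s) h (lit v).1 ↔ (lit v).2 = true) :=
        fun hh => hns ⟨_, hl, hh⟩
      have hout : ∀ i, place g i ≠ v.val + 1 := by
        intro i hi
        apply hvg
        simp only [Finset.mem_map, Finset.mem_univ, true_and]
        exact ⟨i, Fin.ext (by simpa [place] using hi)⟩
      have hval : asg (place g) (bits s) h (lit v).1 ↔ v ∈ s := by
        have hb : bits s (v.val + 1) ↔ v ∈ s := by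
          constructor
          · rintro ⟨j, hj, e⟩
            have : j = v := Fin.ext (by omega)
            exact this ▸ hj
          · intro hv
            exact ⟨v, hv, rfl⟩
        rw [← hb]
        generalize (lit v).1 = x at hvl
        cases x with
        | q a w =>
          simp only [vert, Option.some.injEq] at hvl
          subst hvl
          simp only [asg]
          constructor
          · rintro (⟨i, hi, -⟩ | hh)
            · exact absurd hi (hout i)
            · exact hh.2
          · intro hh
            exact Or.inr ⟨hout, hh⟩
        | z a w =>
          simp only [vert, Option.some.injEq] at hvl
          subst hvl
          simp only [asg]
          constructor
          · rintro (⟨i, hi, -⟩ | hh)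
            · exact absurd hi (hout i)
            · exact hh.2
          · intro hh
            exact Or.inr ⟨hout, hh⟩
        | _ => simp [vert] at hvl
      rw [hval] at hnl
      tauto
    have h2 := (Finset.card_le_card h1).trans
      (Finset.card_biUnion_le_card_mul _ _ (2 ^ (n - (M.card - k))) (by
        intro g _
        rw [Finset.card_product, Finset.card_singleton, one_mul]
        have hcb := card_bits (M \ Finset.univ.map g) (fun v => ¬ (lit v).2 = true)
        refine le_trans (le_of_eq (by congr)) (hcb.trans ?_)
        refine Nat.pow_le_pow_right (by norm_num) ?_
        have := Finset.le_card_sdiff (Finset.univ.map g) M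
        simp only [Finset.card_map, Finset.card_univ, Fintype.card_fin] at this
        omega))
    have h3 : (Finset.univ : Finset (Fin k ↪ Fin n)).card = n.descFactorial k := by
      rw [Finset.card_univ, Fintype.card_embedding_eq]; simp
    rw [h3] at h2
    refine (Nat.mul_le_mul_right _ h2).trans ?_
    rw [mul_assoc, ← pow_add]
    exact Nat.mul_le_mul_left _ (Nat.pow_le_pow_right (by norm_num) (by omega))

open Classical in
lemma size_bound {n k : ℕ} (hn : 4 ≤ n) (hk : 4 ≤ k) (hkn : k ≤ n) (L : ℕ)
    (π : ResRefutation ERVar (ERPHP n k)) :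
    n.descFactorial k ≤ π.size * (k * (n * L ^ (k - 1))) ∨ 2 ^ (L + 1 - k) ≤ π.size := by
  by_contra hcon
  push Not at hcon
  obtain ⟨c1, c2⟩ := hcon
  set N : Clause ERVar → ℕ := fun C => ((Finset.univ ×ˢ Finset.univ).filter
        fun x : (Fin k ↪ Fin n) × Finset (Fin n) => Bad C x.1 x.2).card with hN
  have hD : 0 < n.descFactorial k := Nat.descFactorial_pos.2 hkn
  have htot : n.descFactorial k * 2 ^ n ≤ ∑ C ∈ π.lines.toFinset, N C := by
    have h0 : ((Finset.univ ×ˢ Finset.univ : Finset ((Fin k ↪ Fin n) × Finset (Fin n)))).card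
        = n.descFactorial k * 2 ^ n := by
      rw [Finset.card_product, Finset.card_univ, Fintype.card_embedding_eq]; simp
    rw [← h0]
    refine le_trans (Finset.card_le_card ?_) Finset.card_biUnion_le
    rintro ⟨g, s⟩ -
    obtain ⟨C, hC, hb⟩ := exists_wide hn hk (place g)
      (fun i j hij => g.injective (Fin.ext (by simpa [place] using hij)))
      (fun i => by simp [place]) (fun i => (g i).isLt) (bits s) π
    simp only [Finset.mem_biUnion, List.mem_toFinset, Finset.mem_filter, Finset.mem_product,
      Finset.mem_univ, true_and]
    exact ⟨C, hC, hb⟩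
  have hcard : π.lines.toFinset.card ≤ π.size := List.toFinset_card_le _
  have hpos : 0 < π.size := List.length_pos_iff.2 π.ne
  have hlt : ∀ C, π.size * N C < n.descFactorial k * 2 ^ n := by
    intro C
    rcases card_bad (n := n) (k := k) L C with hb | hb
    · calc π.size * N C ≤ π.size * (k * (n * L ^ (k - 1)) * 2 ^ n) := Nat.mul_le_mul_left _ hb
        _ = (π.size * (k * (n * L ^ (k - 1)))) * 2 ^ n := by ring
        _ < _ := Nat.mul_lt_mul_of_pos_right c1 (by positivity)
    · rcases Nat.eq_zero_or_pos (N C) with h0 | h0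
      · rw [h0, mul_zero]; positivity
      · calc π.size * N C < 2 ^ (L + 1 - k) * N C := Nat.mul_lt_mul_of_pos_right c2 h0
          _ = N C * 2 ^ (L + 1 - k) := mul_comm _ _
          _ ≤ _ := hb
  have hne : π.lines.toFinset.Nonempty := by
    rw [List.toFinset_nonempty_iff]; exact π.ne
  have : π.size * ∑ C ∈ π.lines.toFinset, N C < π.size * (n.descFactorial k * 2 ^ n) := by
    rw [Finset.mul_sum]
    refine (Finset.sum_lt_sum_of_nonempty hne fun C _ => hlt C).trans_le ?_
    rw [Finset.sum_const, smul_eq_mul]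
    exact Nat.mul_le_mul_right _ hcard
  exact absurd (Nat.lt_of_mul_lt_mul_left this) (not_lt.2 htot)

/-- there exist a constant `c > 0` and an integer `n₀` such that
for every `n ≥ n₀` and every integer `k` with `4 ≤ k ≤ n/(4·log₂ n)`, every
resolution refutation of `ERPHP` has size at least
`c · n^(k−1) / (k · (16/15)^(k−1) · (2k·log₂ n)^k)`. -/
theorem erphp_resolution_size_lower_bound :
    ∃ c : ℝ, 0 < c ∧ ∃ n₀ : ℕ, ∀ n k : ℕ, n₀ ≤ n → 4 ≤ k →
      (k : ℝ) ≤ (n : ℝ) / (4 * Real.logb 2 (n : ℝ)) →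
      ∀ π : ResRefutation ERVar (ERPHP n k),
        c * (n : ℝ) ^ (k - 1) /
            ((k : ℝ) * (16 / 15 : ℝ) ^ (k - 1) * (2 * (k : ℝ) * Real.logb 2 (n : ℝ)) ^ k)
          ≤ (π.size : ℝ) := by
  refine ⟨15 / 16, by norm_num, 16, ?_⟩
  intro n k hn hk hkn π
  set l := Real.logb 2 (n : ℝ) with hl
  have hnR : (16 : ℝ) ≤ n := by exact_mod_cast hn
  have hkR : (4 : ℝ) ≤ k := by exact_mod_cast hk
  have hl4 : 4 ≤ l := by
    rw [hl, Real.le_logb_iff_rpow_le (by norm_num) (by linarith)]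
    norm_num
    linarith
  have hkn16 : (k : ℝ) * 16 ≤ n := by
    rw [le_div_iff₀ (by linarith)] at hkn
    nlinarith
  have hkn' : k * 16 ≤ n := by exact_mod_cast hkn16
  set m : ℝ := 2 * (k : ℝ) * l with hm
  have hm1 : 1 ≤ m := by rw [hm]; nlinarith
  set L := ⌊m⌋₊ with hLdef
  have hLm : (L : ℝ) ≤ m := Nat.floor_le (by linarith)
  have hLm' : m < L + 1 := Nat.lt_floor_add_one m
  have hsz : 0 ≤ (π.size : ℝ) := Nat.cast_nonneg _
  obtain ⟨j, rfl⟩ : ∃ j, k = j + 1 := ⟨k - 1, by omega⟩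
  simp only [Nat.add_sub_cancel]
  have hmj : (1 : ℝ) ≤ m ^ (j + 1) := one_le_pow₀ hm1
  have h16 : (1 : ℝ) ≤ (16 / 15) ^ j := one_le_pow₀ (by norm_num)
  rcases size_bound (by omega) hk (by omega) L π with hb | hb
  · have hD : ((n : ℝ) * (15 / 16)) ^ (j + 1) ≤ (n.descFactorial (j + 1) : ℝ) := by
      have h1 : ((n + 1 - (j + 1) : ℕ) : ℝ) ^ (j + 1) ≤ (n.descFactorial (j + 1) : ℝ) := by
        exact_mod_cast Nat.pow_sub_le_descFactorial n (j + 1)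
      refine le_trans (pow_le_pow_left₀ (by positivity) ?_ _) h1
      rw [Nat.cast_sub (by omega)]
      push_cast at hkn16 ⊢
      linarith
    have hb' : (n.descFactorial (j + 1) : ℝ) ≤
        π.size * (((j + 1 : ℕ) : ℝ) * (n * (L : ℝ) ^ j)) := by
      exact_mod_cast hb
    have hLj : (L : ℝ) ^ j ≤ m ^ (j + 1) :=
      (pow_le_pow_left₀ (Nat.cast_nonneg _) hLm _).trans
        (pow_le_pow_right₀ hm1 (Nat.le_succ _))
    have h3 : ((n : ℝ) * (15 / 16)) ^ (j + 1) ≤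
        π.size * (((j + 1 : ℕ) : ℝ) * (n * m ^ (j + 1))) := by
      refine (hD.trans hb').trans ?_
      gcongr
    have h4 : (15 / 16 : ℝ) ^ j * (16 / 15) ^ j = 1 := by
      rw [← mul_pow]; norm_num
    rw [div_le_iff₀ (by positivity)]
    have h5 : (n : ℝ) * (15 / 16 * n ^ j) ≤
        n * (π.size * (((j + 1 : ℕ) : ℝ) * (16 / 15) ^ j * m ^ (j + 1))) := by
      calc (n : ℝ) * (15 / 16 * n ^ j)
          = n * (15 / 16 * n ^ j) * ((15 / 16 : ℝ) ^ j * (16 / 15) ^ j) := by rw [h4, mul_one]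
        _ = ((n : ℝ) * (15 / 16)) ^ (j + 1) * (16 / 15) ^ j := by
            rw [mul_pow, pow_succ, pow_succ]; ring
        _ ≤ (π.size * (((j + 1 : ℕ) : ℝ) * (n * m ^ (j + 1)))) * (16 / 15) ^ j := by gcongr
        _ = _ := by ring
    exact le_of_mul_le_mul_left h5 (by linarith)
  · have h1 : (n : ℝ) ^ (j + 1) ≤ π.size := by
      have h2 : ((2 : ℝ) ^ (L + 1 - (j + 1)) : ℝ) ≤ π.size := by exact_mod_cast hb
      refine le_trans ?_ h2
      have h3 : (n : ℝ) = (2 : ℝ) ^ l := by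
        rw [hl, Real.rpow_logb (by norm_num) (by norm_num) (by linarith)]
      have h4 : (n : ℝ) ^ (j + 1) = (2 : ℝ) ^ (l * ((j + 1 : ℕ) : ℝ)) := by
        rw [Real.rpow_mul (by norm_num), ← h3, Real.rpow_natCast]
      rw [h4, ← Real.rpow_natCast]
      refine Real.rpow_le_rpow_of_exponent_le (by norm_num) ?_
      have h5 : ((L + 1 : ℕ) : ℝ) ≤ ((L + 1 - (j + 1) : ℕ) : ℝ) + ((j + 1 : ℕ) : ℝ) := by
        exact_mod_cast (by omega : L + 1 ≤ L + 1 - (j + 1) + (j + 1))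
      have h6 : ((L + 1 : ℕ) : ℝ) = L + 1 := by push_cast; ring
      rw [h6] at h5
      nlinarith
    refine le_trans ?_ h1
    have hj1 : (n : ℝ) ^ j ≤ (n : ℝ) ^ (j + 1) :=
      pow_le_pow_right₀ (by linarith) (Nat.le_succ _)
    have hden : 1 ≤ ((j + 1 : ℕ) : ℝ) * (16 / 15) ^ j * m ^ (j + 1) := by
      have : (1 : ℝ) ≤ ((j + 1 : ℕ) : ℝ) := by linarith
      exact one_le_mul_of_one_le_of_one_le (one_le_mul_of_one_le_of_one_le this h16) hmj
    refine (div_le_self (by positivity) hden).trans ?_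
    have : 0 ≤ (n : ℝ) ^ j := by positivity
    linarith

end NarrowProofs
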